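/- Let F be an algebraically closed field of characteristic zero, n ≥ 1, and Q ⊆ {2,…,n} nonempty. Let M(Q) be the set of nilpotent n×n matrices all of whose Jordan block sizes lie in Q ∪ {1}. If Q contains all integers 2,…,⌊n/2⌋+1, then M(Q) is invariant under conjugation and contains the linear span of any two of its commuting elements. -/

import Mathlib

/-- `X` has a Jordan block of size `l`, expressed via kernel dimensions:
the number of blocks of size `≥ l` exceeds the number of blocks of size `≥ l + 1`,
i.e. `dim Ker(X^l) - dim Ker(X^(l-1)) > dim Ker(X^(l+1)) - dim Ker(X^l)`. -/
def hasJordanBlockOfSize {F : Type*} [Field F] {n : ℕ}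
    (X : Matrix (Fin n) (Fin n) F) (l : ℕ) : Prop :=
  2 * Module.finrank F (LinearMap.ker (Matrix.toLin' (X ^ l))) >
    Module.finrank F (LinearMap.ker (Matrix.toLin' (X ^ (l + 1))))
      + Module.finrank F (LinearMap.ker (Matrix.toLin' (X ^ (l - 1))))

/-- `M(Q)`: the set of nilpotent `n × n` matrices all of whose Jordan block sizes
lie in `Q ∪ {1}`. -/
def MQ (F : Type*) [Field F] (n : ℕ) (Q : Set ℕ) : Set (Matrix (Fin n) (Fin n) F) :=
  {X | IsNilpotent X ∧ ∀ l : ℕ, hasJordanBlockOfSize X l → l ∈ Q ∪ {1}}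

open Module

section CommutingPencil

variable {F V : Type*} [Field F] [AddCommGroup V] [Module F V]

/-- The decreasing filtration of `V` by `m ^ j • V`, where `m` is the ideal generated by `A` and `B`
in the algebra they generate. -/
def pencilFiltration (A B : End F V) : ℕ → Submodule F V
  | 0 => ⊤
  | j + 1 => (pencilFiltration A B j).map A ⊔ (pencilFiltration A B j).map B

theorem map_left_pencilFiltration_le (A B : End F V) (j : ℕ) :
    (pencilFiltration A B j).map A ≤ pencilFiltration A B (j + 1) := le_sup_left

theorem map_right_pencilFiltration_le (A B : End F V) (j : ℕ) :
    (pencilFiltration A B j).map B ≤ pencilFiltration A B (j + 1) := le_sup_right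

theorem pencilFiltration_succ_le (A B : End F V) (j : ℕ) :
    pencilFiltration A B (j + 1) ≤ pencilFiltration A B j := by
  induction j with
  | zero => exact le_top
  | succ j ih => exact sup_le_sup (Submodule.map_mono ih) (Submodule.map_mono ih)

theorem pencilFiltration_antitone (A B : End F V) : Antitone (pencilFiltration A B) :=
  antitone_nat_of_succ_le (pencilFiltration_succ_le A B)

theorem pencilFiltration_comm (A B : End F V) : pencilFiltration A B = pencilFiltration B A := by
  funext j
  induction j with
  | zero => rfl
  | succ j ih => simp only [pencilFiltration, ih, sup_comm]

theorem map_linearCombination_le (A B : End F V) (a b : F) (W : Submodule F V) :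
    W.map (a • A + b • B) ≤ W.map A ⊔ W.map B := by
  rintro _ ⟨x, hx, rfl⟩
  exact Submodule.add_mem_sup (Submodule.smul_mem _ a ⟨x, hx, rfl⟩)
    (Submodule.smul_mem _ b ⟨x, hx, rfl⟩)

theorem pencilFiltration_eq_of_linearCombination {A B Y C : End F V} {a b c d a' b' c' d' : F}
    (hY : Y = a • A + b • B) (hC : C = c • A + d • B)
    (hA : A = a' • Y + b' • C) (hB : B = c' • Y + d' • C) :
    pencilFiltration Y C = pencilFiltration A B := by
  funext j
  induction j with
  | zero => rfl
  | succ j ih =>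
    simp only [pencilFiltration, ih]
    set W := pencilFiltration A B j
    apply le_antisymm
    · exact sup_le (hY ▸ map_linearCombination_le A B a b W)
        (hC ▸ map_linearCombination_le A B c d W)
    · apply sup_le
      · have h := map_linearCombination_le Y C a' b' W
        rwa [← hA] at h
      · have h := map_linearCombination_le Y C c' d' W
        rwa [← hB] at h

theorem range_pow_le_pencilFiltration {A B : End F V} (a b : F) (j : ℕ) :
    LinearMap.range ((a • A + b • B) ^ j) ≤ pencilFiltration A B j := by
  induction j with
  | zero => exact le_top
  | succ j ih =>
    rintro _ ⟨x, rfl⟩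
    rw [pow_succ']
    exact map_linearCombination_le A B a b _ ⟨_, ih ⟨x, rfl⟩, rfl⟩

theorem eq_bot_of_le_map {B : End F V} (hB : IsNilpotent B) {W : Submodule F V}
    (h : W ≤ W.map B) : W = ⊥ := by
  obtain ⟨k, hk⟩ := hB
  have key : ∀ m : ℕ, W ≤ W.map (B ^ m) := by
    intro m
    induction m with
    | zero => simp [Module.End.one_eq_id]
    | succ m ih =>
      rw [pow_succ', Module.End.mul_eq_comp, Submodule.map_comp]
      exact h.trans (Submodule.map_mono ih)
  have := key k
  rwa [hk, Submodule.map_zero, le_bot_iff] at this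

/-- Nakayama's lemma for the ideal generated by two commuting nilpotent endomorphisms. -/
theorem eq_bot_of_le_map_sup_map {A B : End F V} (hAB : Commute A B) (hA : IsNilpotent A)
    (hB : IsNilpotent B) {W : Submodule F V} (hW : W.map A ≤ W)
    (h : W ≤ W.map A ⊔ W.map B) : W = ⊥ := by
  apply eq_bot_of_le_map hB
  obtain ⟨k, hk⟩ := hA
  have key : ∀ m : ℕ, W ≤ W.map (A ^ m) ⊔ W.map B := by
    intro m
    induction m with
    | zero => simp [Module.End.one_eq_id]
    | succ m ih =>
      refine h.trans (sup_le ?_ le_sup_right)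
      refine (Submodule.map_mono ih).trans ?_
      rw [Submodule.map_sup, ← Submodule.map_comp, ← Submodule.map_comp,
        ← Module.End.mul_eq_comp, ← Module.End.mul_eq_comp, ← pow_succ', hAB.eq,
        Module.End.mul_eq_comp, Submodule.map_comp]
      exact sup_le_sup_left (Submodule.map_mono hW) _
  have := key k
  rwa [hk, Submodule.map_zero, bot_sup_eq] at this

theorem pencilFiltration_eq_bot {A B : End F V} (hAB : Commute A B) (hA : IsNilpotent A)
    (hB : IsNilpotent B) {j : ℕ} (h : pencilFiltration A B j ≤ pencilFiltration A B (j + 1)) :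
    pencilFiltration A B j = ⊥ :=
  eq_bot_of_le_map_sup_map hAB hA hB
    ((map_left_pencilFiltration_le A B j).trans (pencilFiltration_succ_le A B j)) h

variable [FiniteDimensional F V]

theorem finrank_pencilFiltration_lt {A B : End F V} (hAB : Commute A B) (hA : IsNilpotent A)
    (hB : IsNilpotent B) {j : ℕ} (h : pencilFiltration A B j ≠ ⊥) :
    finrank F (pencilFiltration A B (j + 1)) < finrank F (pencilFiltration A B j) :=
  Submodule.finrank_lt_finrank_of_lt <| lt_of_le_not_ge (pencilFiltration_succ_le A B j)
    fun h' => h (pencilFiltration_eq_bot hAB hA hB h')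

theorem exists_smul_add_of_finrank_eq_succ {W U : Submodule F V} (hUW : U ≤ W)
    (h : finrank F W = finrank F U + 1) {x : V} (hx : x ∈ W) (hxU : x ∉ U) {y : V} (hy : y ∈ W) :
    ∃ c : F, y - c • x ∈ U := by
  have hle : U ⊔ F ∙ x ≤ W := sup_le hUW ((Submodule.span_singleton_le_iff_mem x W).2 hx)
  have hlt : U < U ⊔ F ∙ x := lt_of_le_of_ne le_sup_left fun h' =>
    hxU (h' ▸ Submodule.mem_sup_right (Submodule.mem_span_singleton_self x))
  have heq : U ⊔ F ∙ x = W := Submodule.eq_of_le_of_finrank_le hle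
    (h ▸ Submodule.finrank_lt_finrank_of_lt hlt)
  rw [← heq] at hy
  obtain ⟨u, hu, z, hz, rfl⟩ := Submodule.mem_sup.1 hy
  obtain ⟨c, rfl⟩ := Submodule.mem_span_singleton.1 hz
  exact ⟨c, by simpa using hu⟩

/-- If a graded piece of the filtration is one-dimensional and spanned by the image of `A`, then a
combination `B - c • A` raises the degree on that piece by two. -/
theorem exists_map_sub_smul_le {A B : End F V} (hAB : Commute A B) {i : ℕ}
    (hi : finrank F (pencilFiltration A B (i + 1)) = finrank F (pencilFiltration A B (i + 2)) + 1)
    (hx : ¬ (pencilFiltration A B i).map A ≤ pencilFiltration A B (i + 2)) :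
    ∃ c : F, (pencilFiltration A B (i + 1)).map (B - c • A) ≤ pencilFiltration A B (i + 3) := by
  obtain ⟨_, ⟨x, hxi, rfl⟩, hAx⟩ := SetLike.not_le_iff_exists.1 hx
  have hspan := fun {y : V} => exists_smul_add_of_finrank_eq_succ (y := y)
    (pencilFiltration_succ_le A B (i + 1)) hi
    (map_left_pencilFiltration_le A B i ⟨x, hxi, rfl⟩) hAx
  obtain ⟨c, hc⟩ := hspan (map_right_pencilFiltration_le A B i ⟨x, hxi, rfl⟩)
  refine ⟨c, ?_⟩
  rintro _ ⟨y, hy, rfl⟩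
  obtain ⟨d, hd⟩ := hspan hy
  have hCA : (B - c • A) (A x) = A (B x - c • A x) := by
    have := LinearMap.congr_fun hAB.eq x
    simp only [Module.End.mul_apply] at this
    simp [this]
  have hy' : (B - c • A) y = (B (y - d • A x) - c • A (y - d • A x)) + d • A (B x - c • A x) := by
    rw [← hCA]
    simp only [LinearMap.sub_apply, LinearMap.smul_apply, map_sub, map_smul]
    module
  rw [hy']
  have hA' := fun {z : V} (hz : z ∈ pencilFiltration A B (i + 2)) =>
    map_left_pencilFiltration_le A B (i + 2) ⟨z, hz, rfl⟩
  have hB' := map_right_pencilFiltration_le A B (i + 2) ⟨_, hd, rfl⟩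
  exact add_mem (sub_mem hB' (Submodule.smul_mem _ _ (hA' hd))) (Submodule.smul_mem _ _ (hA' hc))

omit [FiniteDimensional F V] in
theorem map_pencilFiltration_le_add {Y C : End F V} (hYC : Commute Y C) {i : ℕ}
    (hC : (pencilFiltration Y C i).map C ≤ pencilFiltration Y C (i + 2)) (k : ℕ) :
    (pencilFiltration Y C (i + k)).map C ≤ pencilFiltration Y C (i + k + 2) := by
  induction k with
  | zero => exact hC
  | succ k ih =>
    change Submodule.map C (Submodule.map Y _ ⊔ Submodule.map C _) ≤ _
    rw [Submodule.map_sup, ← Submodule.map_comp, ← Module.End.mul_eq_comp, ← hYC.eq,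
      Module.End.mul_eq_comp, Submodule.map_comp]
    exact sup_le ((Submodule.map_mono ih).trans (map_left_pencilFiltration_le Y C _))
      ((Submodule.map_mono ih).trans (map_right_pencilFiltration_le Y C _))

/-- If `C` raises the degree by two on a one-dimensional graded piece that is not the last one,
then the last nonzero step of the filtration is the image of a power of `Y`. -/
theorem pow_ne_zero_of_map_le {Y C : End F V} (hYC : Commute Y C) (hY : IsNilpotent Y)
    (hCn : IsNilpotent C) {i M : ℕ}
    (hi : finrank F (pencilFiltration Y C i) = finrank F (pencilFiltration Y C (i + 1)) + 1)
    (hC : (pencilFiltration Y C i).map C ≤ pencilFiltration Y C (i + 2))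
    (hiM : i + 1 ≤ M) (hM : pencilFiltration Y C M ≠ ⊥)
    (hM' : pencilFiltration Y C (M + 1) = ⊥) : Y ^ M ≠ 0 := by
  have hprev : ∀ k, k + 1 = i → (pencilFiltration Y C k).map C ≤ pencilFiltration Y C (i + 1) := by
    rintro k rfl _ ⟨w, hw, rfl⟩
    by_contra hz
    have hYz : Y (C w) ∈ pencilFiltration Y C (k + 1 + 2) := by
      have := LinearMap.congr_fun hYC.eq w
      simp only [Module.End.mul_apply] at this
      rw [this]
      exact hC ⟨_, map_left_pencilFiltration_le Y C k ⟨w, hw, rfl⟩, rfl⟩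
    have hle : pencilFiltration Y C (k + 1 + 1) ≤ pencilFiltration Y C (k + 1 + 2) := by
      refine sup_le ?_ hC
      rintro _ ⟨y, hy, rfl⟩
      obtain ⟨d, hd⟩ := exists_smul_add_of_finrank_eq_succ (pencilFiltration_succ_le Y C (k + 1))
        hi (map_right_pencilFiltration_le Y C k ⟨w, hw, rfl⟩) hz hy
      have := add_mem (map_left_pencilFiltration_le Y C (k + 1 + 1) ⟨_, hd, rfl⟩)
        (Submodule.smul_mem _ d hYz)
      simpa using this
    have hbot := pencilFiltration_eq_bot hYC hY hCn hle
    exact hM (le_bot_iff.1 (hbot ▸ pencilFiltration_antitone Y C hiM))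
  have hdown : ∀ k m, m + k = i →
      pencilFiltration Y C i ≤ (pencilFiltration Y C m).map (Y ^ k) ⊔
        pencilFiltration Y C (i + 1) := by
    intro k
    induction k with
    | zero =>
      rintro m rfl
      simp [Module.End.one_eq_id]
    | succ k ih =>
      intro m hm
      refine (ih (m + 1) (by omega)).trans (sup_le ?_ le_sup_right)
      change Submodule.map (Y ^ k) (Submodule.map Y _ ⊔ Submodule.map C _) ≤ _
      rw [Submodule.map_sup, ← Submodule.map_comp, ← Submodule.map_comp,
        ← Module.End.mul_eq_comp, ← Module.End.mul_eq_comp, ← pow_succ]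
      refine sup_le_sup_left ?_ _
      rw [(hYC.pow_left k).eq, Module.End.mul_eq_comp, Submodule.map_comp]
      have hpow : ∀ q, (pencilFiltration Y C m).map (Y ^ q) ≤ pencilFiltration Y C (m + q) := by
        intro q
        induction q with
        | zero => simp [Module.End.one_eq_id]
        | succ q ihq =>
          rw [pow_succ', Module.End.mul_eq_comp, Submodule.map_comp]
          exact (Submodule.map_mono ihq).trans (map_left_pencilFiltration_le Y C _)
      exact (Submodule.map_mono (hpow k)).trans (hprev (m + k) (by omega))
  have hup : ∀ k, pencilFiltration Y C (i + k) ≤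
      LinearMap.range (Y ^ (i + k)) ⊔ pencilFiltration Y C (i + k + 1) := by
    intro k
    induction k with
    | zero =>
      have := hdown i 0 (by omega)
      rwa [show pencilFiltration Y C 0 = ⊤ from rfl, Submodule.map_top] at this
    | succ k ih =>
      refine sup_le ?_ ((map_pencilFiltration_le_add hYC hC k).trans le_sup_right)
      refine (Submodule.map_mono ih).trans ?_
      rw [Submodule.map_sup, ← LinearMap.range_comp, ← Module.End.mul_eq_comp, ← pow_succ']
      exact sup_le_sup_left (map_left_pencilFiltration_le Y C _) _
  intro h0
  have := hup (M - i)
  rw [show i + (M - i) = M by omega, h0, hM', LinearMap.range_zero, sup_bot_eq, le_bot_iff] at this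
  exact hM this

/-- Dimension count: some graded piece of positive degree `i` is at most one-dimensional, with
control on `i` in terms of the length of the filtration. -/
theorem exists_finrank_pencilFiltration_le {A B : End F V} (hAB : Commute A B)
    (hA : IsNilpotent A) (hB : IsNilpotent B) {M : ℕ} (hM : pencilFiltration A B M ≠ ⊥)
    (hM' : pencilFiltration A B (M + 1) = ⊥) :
    ∃ i, M + (i + 1) ≤ finrank F V ∧
      finrank F (pencilFiltration A B (i + 1)) ≤ finrank F (pencilFiltration A B (i + 2)) + 1 := by
  classical
  have hex : ∃ i, finrank F (pencilFiltration A B (i + 1)) ≤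
      finrank F (pencilFiltration A B (i + 2)) + 1 := ⟨M, by rw [hM', finrank_bot]; exact Nat.zero_le _⟩
  have hstep : ∀ j ≤ M, finrank F (pencilFiltration A B (j + 1)) + 1 ≤
      finrank F (pencilFiltration A B j) := fun j hj =>
    finrank_pencilFiltration_lt hAB hA hB fun h =>
      hM (le_bot_iff.1 (h ▸ pencilFiltration_antitone A B hj))
  have hiM : Nat.find hex ≤ M := Nat.find_min' hex (by rw [hM', finrank_bot]; exact Nat.zero_le _)
  have htail : ∀ k ≤ M + 1, k ≤ finrank F (pencilFiltration A B (M + 1 - k)) := by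
    intro k
    induction k with
    | zero => simp
    | succ k ih =>
      intro hk
      have h1 := ih (by omega)
      have h2 := hstep (M + 1 - (k + 1)) (by omega)
      rw [show M + 1 - (k + 1) + 1 = M + 1 - k by omega] at h2
      omega
  have hhead : ∀ k ≤ Nat.find hex, finrank F (pencilFiltration A B (k + 1)) + 2 * k ≤
      finrank F (pencilFiltration A B 1) := by
    intro k
    induction k with
    | zero => simp
    | succ k ih =>
      intro hk
      have h1 := ih (by omega)
      have h2 := Nat.find_min hex (m := k) (by omega)
      change finrank F (pencilFiltration A B (k + 2)) + 2 * (k + 1) ≤ _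
      omega
  refine ⟨Nat.find hex, ?_, Nat.find_spec hex⟩
  have h0 : finrank F (pencilFiltration A B 1) + 1 ≤ finrank F (pencilFiltration A B 0) :=
    hstep 0 (by omega)
  have h1 := hhead _ le_rfl
  have h2 := htail (M - Nat.find hex) (by omega)
  rw [show M + 1 - (M - Nat.find hex) = Nat.find hex + 1 by omega] at h2
  have h3 : finrank F (pencilFiltration A B 0) = finrank F V := finrank_top F V
  rw [h3] at h0
  omega

theorem exists_pencilFiltration_eq_bot {A B : End F V} (hAB : Commute A B)
    (hA : IsNilpotent A) (hB : IsNilpotent B) : ∃ N, pencilFiltration A B N = ⊥ := by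
  by_contra! h
  have key : ∀ k, finrank F (pencilFiltration A B k) + k ≤ finrank F V := by
    intro k
    induction k with
    | zero => simpa using Submodule.finrank_le (pencilFiltration A B 0)
    | succ k ih => have := finrank_pencilFiltration_lt hAB hA hB (h k); omega
  have := key (finrank F V + 1)
  omega

omit [FiniteDimensional F V] in
/-- If `C` raises the degree by two from degree `i` on, then the filtration of length `M + 1` is
exhausted by the powers of `C` with exponent at least `(M + i + 1) / 2`. -/
theorem smul_pow_eq_zero_of_map_le {Y C : End F V} (hYC : Commute Y C) {i l M : ℕ} (t : F)
    (hC : (pencilFiltration Y C i).map C ≤ pencilFiltration Y C (i + 2))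
    (hM' : pencilFiltration Y C (M + 1) = ⊥) (hl : M + i + 1 ≤ 2 * l) (hil : i ≤ l) :
    (t • C) ^ l = 0 := by
  have key : ∀ k, LinearMap.range (C ^ (i + k)) ≤ pencilFiltration Y C (i + 2 * k) := by
    intro k
    induction k with
    | zero => simpa using range_pow_le_pencilFiltration (A := Y) (B := C) 0 1 i
    | succ k ih =>
      rw [← add_assoc, pow_succ', Module.End.mul_eq_comp, LinearMap.range_comp]
      refine (Submodule.map_mono ih).trans ?_
      exact map_pencilFiltration_le_add hYC hC (2 * k)
  have h := (key (l - i)).trans (pencilFiltration_antitone Y C (show M + 1 ≤ _ by omega))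
  rw [hM', le_bot_iff, LinearMap.range_eq_bot, show i + (l - i) = l by omega] at h
  rw [smul_pow, h, smul_zero]

/-- The special case of `nilpotencyIndex_of_linearCombination` where the image of `A` spans a
one-dimensional graded piece of the filtration. -/
theorem index_eq_of_map_not_le {A B : End F V} (hAB : Commute A B)
    (hA : IsNilpotent A) (hB : IsNilpotent B) {a b : F} {l i M : ℕ}
    (hX : (a • A + b • B) ^ (l + 1) = 0) (hX' : (a • A + b • B) ^ l ≠ 0)
    (hM : pencilFiltration A B M ≠ ⊥) (hM' : pencilFiltration A B (M + 1) = ⊥)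
    (hlM : l ≤ M) (hiM : M + (i + 1) < 2 * l)
    (hi : finrank F (pencilFiltration A B (i + 1)) = finrank F (pencilFiltration A B (i + 2)) + 1)
    (hx : ¬ (pencilFiltration A B i).map A ≤ pencilFiltration A B (i + 2)) :
    M = l ∧ A ^ l ≠ 0 := by
  obtain ⟨c, hc⟩ := exists_map_sub_smul_le hAB hi hx
  set C := B - c • A with hCdef
  have hAC : Commute A C := hAB.sub_right ((Commute.refl A).smul_right c)
  have hCn : IsNilpotent C := (hAB.symm.smul_right c).isNilpotent_sub hB (hA.smul c)
  have hfil : pencilFiltration A C = pencilFiltration A B :=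
    pencilFiltration_eq_of_linearCombination (a := 1) (b := 0) (c := -c) (d := 1)
      (a' := 1) (b' := 0) (c' := c) (d' := 1) (by module) (by rw [hCdef]; module)
      (by module) (by rw [hCdef]; module)
  set s := a + b * c with hs
  have hXC : a • A + b • B = s • A + b • C := by rw [hs, hCdef]; module
  have hs0 : s ≠ 0 := by
    intro h0
    apply hX'
    rw [hXC, h0, zero_smul, zero_add]
    rw [← hfil] at hc hM'
    exact smul_pow_eq_zero_of_map_le (i := i + 1) hAC b hc hM' (by omega) (by omega)
  have hXn : IsNilpotent (a • A + b • B) := ⟨l + 1, hX⟩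
  have hXcomm : Commute (a • A + b • B) C := by
    rw [hXC]
    exact (hAC.smul_left s).add_left ((Commute.refl C).smul_left b)
  have hfilX : pencilFiltration (a • A + b • B) C = pencilFiltration A B := by
    rw [← hfil]
    refine pencilFiltration_eq_of_linearCombination (a := s) (b := b) (c := 0) (d := 1)
      (a' := s⁻¹) (b' := -(s⁻¹ * b)) (c' := 0) (d' := 1) hXC (by module) ?_ (by module)
    rw [hXC, smul_add, smul_smul, smul_smul, inv_mul_cancel₀ hs0]
    module
  have hXM : (a • A + b • B) ^ M ≠ 0 := by
    rw [← hfilX] at hi hc hM hM'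
    exact pow_ne_zero_of_map_le hXcomm hXn hCn hi hc (by omega) hM hM'
  have hAM : A ^ M ≠ 0 := by
    rw [← hfil] at hi hc hM hM'
    exact pow_ne_zero_of_map_le hAC hA hCn hi hc (by omega) hM hM'
  have hMl : M = l := by
    by_contra hne
    exact hXM (pow_eq_zero_of_le (show l + 1 ≤ M by omega) hX)
  exact ⟨hMl, hMl ▸ hAM⟩

/-- If a combination of two commuting nilpotent endomorphisms has nilpotency index `l + 1` with
`finrank F V < 2 * l`, then neither endomorphism has larger index and at least one has the same. -/
theorem nilpotencyIndex_of_linearCombination {A B : End F V} (hAB : Commute A B)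
    (hA : IsNilpotent A) (hB : IsNilpotent B) {a b : F} {l : ℕ}
    (hX : (a • A + b • B) ^ (l + 1) = 0) (hX' : (a • A + b • B) ^ l ≠ 0)
    (hl : finrank F V < 2 * l) :
    A ^ (l + 1) = 0 ∧ B ^ (l + 1) = 0 ∧ (A ^ l ≠ 0 ∨ B ^ l ≠ 0) := by
  classical
  have hex := exists_pencilFiltration_eq_bot hAB hA hB
  have hlN : l < Nat.find hex := by
    by_contra! hle
    have h := (range_pow_le_pencilFiltration (A := A) (B := B) a b l).trans
      (pencilFiltration_antitone A B hle)
    rw [Nat.find_spec hex, le_bot_iff, LinearMap.range_eq_bot] at h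
    exact hX' h
  obtain ⟨M, hMN⟩ : ∃ M, Nat.find hex = M + 1 := ⟨Nat.find hex - 1, by omega⟩
  have hM' : pencilFiltration A B (M + 1) = ⊥ := hMN ▸ Nat.find_spec hex
  have hM : pencilFiltration A B M ≠ ⊥ := Nat.find_min hex (by omega)
  obtain ⟨i, hi, hfin⟩ := exists_finrank_pencilFiltration_le hAB hA hB hM hM'
  have hne : pencilFiltration A B (i + 1) ≠ ⊥ := fun h =>
    hM (le_bot_iff.1 (h ▸ pencilFiltration_antitone A B (show i + 1 ≤ M by omega)))
  have hlt : finrank F (pencilFiltration A B (i + 2)) < finrank F (pencilFiltration A B (i + 1)) :=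
    finrank_pencilFiltration_lt hAB hA hB hne
  have hfin' : finrank F (pencilFiltration A B (i + 1)) =
      finrank F (pencilFiltration A B (i + 2)) + 1 := by omega
  have main : M = l ∧ (A ^ l ≠ 0 ∨ B ^ l ≠ 0) := by
    by_cases hx : (pencilFiltration A B i).map A ≤ pencilFiltration A B (i + 2)
    · have hx' : ¬ (pencilFiltration A B i).map B ≤ pencilFiltration A B (i + 2) := fun h =>
        hne (pencilFiltration_eq_bot hAB hA hB (sup_le hx h))
      rw [add_comm] at hX hX'
      rw [pencilFiltration_comm] at hM hM' hfin' hx'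
      obtain ⟨h1, h2⟩ := index_eq_of_map_not_le hAB.symm hB hA hX hX' hM hM' (by omega) (by omega)
        hfin' hx'
      exact ⟨h1, .inr h2⟩
    · obtain ⟨h1, h2⟩ := index_eq_of_map_not_le hAB hA hB hX hX' hM hM' (by omega) (by omega)
        hfin' hx
      exact ⟨h1, .inl h2⟩
  obtain ⟨rfl, hor⟩ := main
  have hAr := range_pow_le_pencilFiltration (A := A) (B := B) 1 0 (M + 1)
  have hBr := range_pow_le_pencilFiltration (A := A) (B := B) 0 1 (M + 1)
  rw [hM', le_bot_iff, LinearMap.range_eq_bot] at hAr hBr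
  exact ⟨by simpa using hAr, by simpa using hBr, hor⟩

theorem finrank_range_pow_succ_add (f : End F V) (j : ℕ) :
    finrank F (LinearMap.range (f ^ (j + 1))) +
      finrank F (LinearMap.ker f ⊓ LinearMap.range (f ^ j) : Submodule F V) =
        finrank F (LinearMap.range (f ^ j)) := by
  have h := LinearMap.finrank_range_add_finrank_ker (f.domRestrict (LinearMap.range (f ^ j)))
  rw [LinearMap.range_domRestrict, ← LinearMap.range_comp, ← Module.End.mul_eq_comp,
    ← pow_succ', LinearMap.ker_domRestrict] at h
  rw [← h, inf_comm, ← Submodule.map_comap_subtype, Submodule.finrank_map_subtype_eq]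

/-- A nilpotent endomorphism with a Jordan block of size `l + 1` has index `l + 1` if two such
blocks do not fit in the space. -/
theorem index_eq_of_finrank_range {f : End F V} (hf : IsNilpotent f) {l : ℕ}
    (h : 2 * finrank F (LinearMap.range (f ^ (l + 1))) <
      finrank F (LinearMap.range (f ^ (l + 2))) + finrank F (LinearMap.range (f ^ l)))
    (hl : finrank F V < 2 * (l + 1)) : f ^ (l + 1) = 0 ∧ f ^ l ≠ 0 := by
  set d : ℕ → ℕ := fun j =>
    finrank F (LinearMap.ker f ⊓ LinearMap.range (f ^ j) : Submodule F V) with hd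
  have hr : ∀ j, finrank F (LinearMap.range (f ^ (j + 1))) + d j =
      finrank F (LinearMap.range (f ^ j)) := finrank_range_pow_succ_add f
  have hanti : Antitone d := antitone_nat_of_succ_le fun j =>
    Submodule.finrank_mono (inf_le_inf_left _ (by
      rw [pow_succ]
      exact LinearMap.range_comp_le_range f (f ^ j)))
  refine ⟨?_, ?_⟩
  · by_contra h0
    have hd1 : d (l + 1) ≠ 0 := by
      intro hd0
      have hconst : ∀ k, finrank F (LinearMap.range (f ^ (l + 1 + k))) =
          finrank F (LinearMap.range (f ^ (l + 1))) := by
        intro k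
        induction k with
        | zero => rfl
        | succ k ih =>
          have h1 := hr (l + 1 + k)
          have h2 := hanti (show l + 1 ≤ l + 1 + k by omega)
          rw [← add_assoc]
          omega
      obtain ⟨N, hN⟩ := hf
      have h3 := hconst N
      rw [pow_add, hN, mul_zero, LinearMap.range_zero, finrank_bot] at h3
      exact h0 (LinearMap.range_eq_bot.1 (Submodule.finrank_eq_zero.1 h3.symm))
    have hdl : 2 ≤ d l := by
      have h1 := hr l
      have h2 := hr (l + 1)
      rw [show l + 1 + 1 = l + 2 by omega] at h2
      omega
    have hsum : ∀ k ≤ l + 1, finrank F (LinearMap.range (f ^ k)) + 2 * k ≤ finrank F V := by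
      intro k
      induction k with
      | zero => intro _; simpa using Submodule.finrank_le (LinearMap.range (f ^ 0))
      | succ k ih =>
        intro hk
        have h1 := hr k
        have h2 := hanti (show k ≤ l by omega)
        have h3 := ih (by omega)
        omega
    have := hsum (l + 1) le_rfl
    omega
  · intro h0
    have h1 := hr l
    have h2 := hr (l + 1)
    have h3 : finrank F (LinearMap.range (f ^ l)) = 0 := by
      rw [h0, LinearMap.range_zero, finrank_bot]
    rw [show l + 1 + 1 = l + 2 by omega] at h2
    omega

end CommutingPencil

theorem finrank_ker_toLin'_add_rank {F : Type*} [Field F] {n : ℕ} (X : Matrix (Fin n) (Fin n) F) :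
    finrank F (LinearMap.ker (Matrix.toLin' X)) + X.rank = n := by
  have h := LinearMap.finrank_range_add_finrank_ker (Matrix.toLin' X)
  rw [finrank_fin_fun] at h
  rw [add_comm]
  exact h

theorem hasJordanBlockOfSize_iff_rank {F : Type*} [Field F] {n : ℕ}
    (X : Matrix (Fin n) (Fin n) F) (l : ℕ) :
    hasJordanBlockOfSize X l ↔ 2 * (X ^ l).rank < (X ^ (l + 1)).rank + (X ^ (l - 1)).rank := by
  have h1 := finrank_ker_toLin'_add_rank (X ^ l)
  have h2 := finrank_ker_toLin'_add_rank (X ^ (l + 1))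
  have h3 := finrank_ker_toLin'_add_rank (X ^ (l - 1))
  unfold hasJordanBlockOfSize
  omega

theorem hasJordanBlockOfSize_of_index {F : Type*} [Field F] {n : ℕ}
    {X : Matrix (Fin n) (Fin n) F} {l : ℕ} (h : X ^ (l + 1) = 0) (h' : X ^ l ≠ 0) :
    hasJordanBlockOfSize X (l + 1) := by
  rw [hasJordanBlockOfSize_iff_rank, h, pow_succ X (l + 1), h]
  simp only [Matrix.rank_zero, mul_zero, zero_add, zero_mul, Nat.add_sub_cancel]
  refine Nat.pos_of_ne_zero fun h0 => h' ?_
  exact Matrix.toLin'.map_eq_zero_iff.1 (LinearMap.range_eq_bot.1 (Submodule.finrank_eq_zero.1 h0))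

theorem hasJordanBlockOfSize_conj {F : Type*} [Field F] {n : ℕ} (g : (Matrix (Fin n) (Fin n) F)ˣ)
    (A : Matrix (Fin n) (Fin n) F) (l : ℕ) :
    hasJordanBlockOfSize ((g : Matrix (Fin n) (Fin n) F) * A *
      ((g⁻¹ : (Matrix (Fin n) (Fin n) F)ˣ) : Matrix (Fin n) (Fin n) F)) l ↔
      hasJordanBlockOfSize A l := by
  have hrank : ∀ k, (((g : Matrix (Fin n) (Fin n) F) * A *
      ((g⁻¹ : (Matrix (Fin n) (Fin n) F)ˣ) : Matrix (Fin n) (Fin n) F)) ^ k).rank =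
      (A ^ k).rank := by
    intro k
    rw [Units.conj_pow,
      Matrix.rank_mul_eq_left_of_isUnit_det _ _ ((Matrix.isUnit_iff_isUnit_det _).1 g⁻¹.isUnit),
      Matrix.rank_mul_eq_right_of_isUnit_det _ _ ((Matrix.isUnit_iff_isUnit_det _).1 g.isUnit)]
  simp only [hasJordanBlockOfSize_iff_rank, hrank]

/-- Theorem 1.3 ("if" direction): over an algebraically closed field of
characteristic zero, if `Q ⊆ {2, …, n}` is nonempty and contains all integers
`2, …, ⌊n/2⌋ + 1`, then `M(Q)` is invariant under conjugation and contains the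
linear span of any two of its commuting elements. -/
theorem stmt18 (F : Type*) [Field F] [IsAlgClosed F] [CharZero F]
    (n : ℕ) (hn : 1 ≤ n)
    (Q : Set ℕ) (hQsub : Q ⊆ Set.Icc 2 n) (hQne : Q.Nonempty)
    (hQ : ∀ m : ℕ, 2 ≤ m → m ≤ n / 2 + 1 → m ∈ Q) :
    (∀ g : (Matrix (Fin n) (Fin n) F)ˣ, ∀ A ∈ MQ F n Q,
      (g : Matrix (Fin n) (Fin n) F) * A *
        ((g⁻¹ : (Matrix (Fin n) (Fin n) F)ˣ) : Matrix (Fin n) (Fin n) F) ∈ MQ F n Q) ∧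
    (∀ A ∈ MQ F n Q, ∀ B ∈ MQ F n Q, Commute A B →
      ∀ a b : F, a • A + b • B ∈ MQ F n Q) := by
  refine ⟨fun g A hA => ⟨?_, fun l hl => hA.2 l ((hasJordanBlockOfSize_conj g A l).1 hl)⟩,
    fun A hA B hB hAB a b => ⟨?_, fun l hl => ?_⟩⟩
  · obtain ⟨k, hk⟩ := hA.1
    exact ⟨k, by rw [Units.conj_pow, hk, mul_zero, zero_mul]⟩
  · exact ((hAB.smul_left a).smul_right b).isNilpotent_add (hA.1.smul a) (hB.1.smul b)
  · have hXn : IsNilpotent (a • A + b • B) :=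
      ((hAB.smul_left a).smul_right b).isNilpotent_add (hA.1.smul a) (hB.1.smul b)
    rcases Nat.lt_or_ge l 2 with hl2 | hl2
    · interval_cases l
      · rw [hasJordanBlockOfSize_iff_rank] at hl
        have := (a • A + b • B).rank_le_card_width
        simp at hl
        simp at this
        omega
      · exact .inr rfl
    by_cases hln : l ≤ n / 2 + 1
    · exact .inl (hQ l hl2 hln)
    obtain ⟨l, rfl⟩ : ∃ k, l = k + 1 := ⟨l - 1, by omega⟩
    let φ := Matrix.toLinAlgEquiv' (R := F) (n := Fin n)
    have hφn : ∀ {Z : Matrix (Fin n) (Fin n) F}, IsNilpotent Z → IsNilpotent (φ Z) :=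
      fun hZ => hZ.map φ
    have hφX : φ (a • A + b • B) = a • φ A + b • φ B := by simp
    have hφpow : ∀ (Z : Matrix (Fin n) (Fin n) F) (k : ℕ), φ Z ^ k = 0 ↔ Z ^ k = 0 := by
      intro Z k
      rw [← map_pow, map_eq_zero_iff φ φ.injective]
    have hφrank : ∀ (Z : Matrix (Fin n) (Fin n) F) (k : ℕ),
        (Z ^ k).rank = finrank F (LinearMap.range (φ Z ^ k)) := by
      intro Z k
      rw [← map_pow]
      rfl
    rw [hasJordanBlockOfSize_iff_rank] at hl
    simp only [hφrank, Nat.add_sub_cancel] at hl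
    have hdim : finrank F (Fin n → F) = n := finrank_fin_fun F
    obtain ⟨h0, h1⟩ := index_eq_of_finrank_range (hφn hXn) hl (by omega)
    rw [hφX] at h0 h1
    obtain ⟨hA0, hB0, hor⟩ := nilpotencyIndex_of_linearCombination (hAB.map φ) (hφn hA.1)
      (hφn hB.1) h0 h1 (by omega)
    rw [hφpow] at hA0 hB0
    rw [Ne, Ne, hφpow, hφpow] at hor
    rcases hor with h | h
    · exact hA.2 _ (hasJordanBlockOfSize_of_index hA0 h)
    · exact hB.2 _ (hasJordanBlockOfSize_of_index hB0 h)
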